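/- arXiv:1404.7303 — 3 statements merged into one kernel-verified Lean document; each statement's English description precedes it below -/
import Mathlib

section
/- For every prime power q = pᵉ with q ≥ 13 and q ≠ 27, writing q⁺ = (q+1)/gcd(2, q+1), Euler's totient φ(q⁺) > 2e. -/
theorem Nat.prime_pow_le_totient_sq {p k : ℕ} (hp : p.Prime) (h3 : 3 ≤ p) (hk : 0 < k) :
    p ^ k ≤ Nat.totient (p ^ k) ^ 2 := by
  rw [Nat.totient_prime_pow hp hk]
  obtain ⟨k, rfl⟩ := Nat.exists_eq_succ_of_ne_zero hk.ne'
  obtain ⟨m, rfl⟩ := Nat.exists_eq_add_of_le h3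
  have h1 : 1 ≤ (3 + m) ^ k := Nat.one_le_pow _ _ (by omega)
  have h2 : 3 + m - 1 = 2 + m := by omega
  rw [h2, Nat.succ_sub_one, pow_succ, mul_pow]
  have h3 : (3 + m) ^ k ≤ ((3 + m) ^ k) ^ 2 := Nat.le_self_pow two_ne_zero _
  exact Nat.mul_le_mul h3 (by nlinarith)

theorem Nat.two_pow_le_two_mul_totient_sq {k : ℕ} (hk : 0 < k) :
    2 ^ k ≤ 2 * Nat.totient (2 ^ k) ^ 2 := by
  rw [Nat.totient_prime_pow Nat.prime_two hk]
  obtain ⟨k, rfl⟩ := Nat.exists_eq_succ_of_ne_zero hk.ne'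
  have h : 2 ^ k ≤ (2 ^ k) ^ 2 := Nat.le_self_pow two_ne_zero _
  simp only [Nat.succ_sub_one, pow_succ 2 k, mul_one]
  omega

theorem Nat.le_totient_sq_of_odd_and_le_two_mul (n : ℕ) :
    (Odd n → n ≤ Nat.totient n ^ 2) ∧ n ≤ 2 * Nat.totient n ^ 2 := by
  induction n using Nat.recOnPosPrimePosCoprime with
  | zero => simp
  | one => simp
  | prime_pow p k hp hk =>
    rcases hp.eq_two_or_odd' with rfl | hodd
    · refine ⟨fun h => ?_, Nat.two_pow_le_two_mul_totient_sq hk⟩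
      exact absurd ((Nat.odd_pow_iff hk.ne').1 h) (by decide)
    · have h3 : 3 ≤ p := by
        have := hp.two_le
        obtain ⟨m, rfl⟩ := hodd
        omega
      have h := Nat.prime_pow_le_totient_sq hp h3 hk
      exact ⟨fun _ => h, by omega⟩
  | coprime a b ha hb hab iha ihb =>
    rw [Nat.totient_mul hab, mul_pow]
    refine ⟨fun h => ?_, ?_⟩
    · obtain ⟨h1, h2⟩ := Nat.odd_mul.1 h
      exact Nat.mul_le_mul (iha.1 h1) (ihb.1 h2)
    · rcases Nat.even_or_odd a with h | h
      · have hb' : Odd b := by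
          by_contra hb'
          exact Nat.not_coprime_of_dvd_of_dvd one_lt_two h.two_dvd
            (Nat.not_odd_iff_even.1 hb').two_dvd hab
        calc a * b ≤ (2 * Nat.totient a ^ 2) * Nat.totient b ^ 2 :=
              Nat.mul_le_mul iha.2 (ihb.1 hb')
          _ = _ := by ring
      · calc a * b ≤ Nat.totient a ^ 2 * (2 * Nat.totient b ^ 2) :=
              Nat.mul_le_mul (iha.1 h) ihb.2
          _ = _ := by ring

theorem Nat.sixteen_mul_sq_le_two_pow {e : ℕ} (he : 11 ≤ e) : 16 * e ^ 2 ≤ 2 ^ e := by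
  induction e, he using Nat.le_induction with
  | base => norm_num
  | succ e he ih =>
    rw [pow_succ 2 e]
    nlinarith

theorem Nat.sixteen_mul_sq_le_sixteen_pow {e : ℕ} (he : 1 ≤ e) : 16 * e ^ 2 ≤ 16 ^ e := by
  induction e, he using Nat.le_induction with
  | base => norm_num
  | succ e he ih =>
    rw [pow_succ 16 e]
    nlinarith

theorem Nat.two_mul_lt_totient_div_gcd {q e : ℕ} (h : 16 * e ^ 2 ≤ q) :
    2 * e < Nat.totient ((q + 1) / Nat.gcd 2 (q + 1)) := by
  set n := (q + 1) / Nat.gcd 2 (q + 1) with hn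
  have h1 : n * Nat.gcd 2 (q + 1) = q + 1 := Nat.div_mul_cancel (Nat.gcd_dvd_right _ _)
  have h2 : Nat.gcd 2 (q + 1) ≤ 2 := Nat.gcd_le_left _ two_pos
  have h3 := (Nat.le_totient_sq_of_odd_and_le_two_mul n).2
  by_contra! h4
  nlinarith [Nat.mul_le_mul_left n h2, Nat.pow_le_pow_left h4 2]

theorem stmt_2 (p e q : ℕ) (hp : p.Prime) (he : 1 ≤ e) (hq : q = p ^ e)
    (h13 : 13 ≤ q) (h27 : q ≠ 27) :
    Nat.totient ((q + 1) / Nat.gcd 2 (q + 1)) > 2 * e := by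
  by_cases hlarge : 16 * e ^ 2 ≤ q
  · exact Nat.two_mul_lt_totient_div_gcd hlarge
  have he' : e < 11 := by
    by_contra! h
    exact hlarge ((Nat.sixteen_mul_sq_le_two_pow h).trans
      (hq ▸ Nat.pow_le_pow_left hp.two_le e))
  have hp' : p < 16 := by
    by_contra! h
    exact hlarge ((Nat.sixteen_mul_sq_le_sixteen_pow he).trans
      (hq ▸ Nat.pow_le_pow_left h e))
  have hp2 := hp.two_le
  subst hq
  interval_cases e <;> interval_cases p <;>
    first
    | (exfalso; revert hp; norm_num; done)
    | (exfalso; revert hlarge; norm_num; done)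
    | (exfalso; revert h13; norm_num; done)
    | (exfalso; revert h27; norm_num; done)
    | decide +kernel
end

section
/- For every integer m ≥ 4, the permutations a = (1,2)(3,4,...,2m) and b = a^g with g = (1,3,4) generate the alternating group A_{2m}, and ord(a) = ord(b) = ord(ab) = 2m - 2. -/
open Equiv Equiv.Perm

/-- The alternating group is generated by the 3-cycles through two given points. -/
theorem alternatingGroup_le_of_swap_mul_swap_mem {α : Type*} [Fintype α] [DecidableEq α]
    {H : Subgroup (Perm α)} {p q : α} (hpq : p ≠ q)
    (h : ∀ k, k ≠ p → swap p q * swap p k ∈ H) : alternatingGroup α ≤ H := by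
  have h₂ (i j : α) (hi : i ≠ p) (hj : j ≠ p) : swap p i * swap p j ∈ H := by
    simpa [mul_assoc] using H.mul_mem (H.inv_mem (h i hi)) (h j hj)
  have h₃ (x y : α) (hxy : x ≠ y) : swap x y * swap p q ∈ H := by
    by_cases hx : x = p
    · subst hx
      exact h₂ y q hxy.symm hpq.symm
    by_cases hy : y = p
    · subst hy
      rw [swap_comm]
      exact h₂ x q hx hpq.symm
    · have : swap x y = swap p x * swap p y * swap p x := by
        rw [swap_comm p y, swap_mul_swap_mul_swap hy hxy.symm]
      rw [this, mul_assoc]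
      exact H.mul_mem (h₂ x y hx hy) (h₂ x q hx hpq.symm)
  have key (σ : Perm α) : (sign σ = 1 → σ ∈ H) ∧ (sign σ = -1 → swap p q * σ ∈ H) := by
    induction σ using swap_induction_on with
    | one => simp [H.one_mem]
    | swap_mul σ x y hxy ih =>
      rw [Perm.sign_mul, sign_swap hxy]
      refine ⟨fun hσ ↦ ?_, fun hσ ↦ ?_⟩
      · simpa [mul_assoc] using
          H.mul_mem (h₃ x y hxy) (ih.2 (by simpa [neg_eq_iff_eq_neg] using hσ))
      · have := H.mul_mem (H.inv_mem (h₃ x y hxy)) (ih.1 (by simpa using hσ))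
        simpa [mul_assoc] using this
  exact fun σ hσ ↦ (key σ).1 (mem_alternatingGroup.mp hσ)

theorem notMem_drop_finRange {n k : ℕ} {x : Fin n} (hx : x.val < k) :
    x ∉ (List.finRange n).drop k := by
  simp only [List.mem_drop_iff_getElem, not_exists]
  intro i hi h
  have := congrArg Fin.val h
  simp at this
  omega

theorem val_swap_mul_formPerm_drop_finRange {n : ℕ} (hn : 4 ≤ n) (x : Fin n) :
    ((swap (⟨0, by omega⟩ : Fin n) ⟨1, by omega⟩ * ((List.finRange n).drop 2).formPerm) x).val =
      if x.val = 0 then 1 else if x.val = 1 then 0 else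
        if x.val = n - 1 then 2 else x.val + 1 := by
  have hnd : ((List.finRange n).drop 2).Nodup := (List.nodup_finRange n).drop
  by_cases hx : x.val < 2
  · rw [Perm.mul_apply, List.formPerm_apply_of_notMem (notMem_drop_finRange hx)]
    obtain h | h : x.val = 0 ∨ x.val = 1 := by omega
    · rw [show x = ⟨0, by omega⟩ from Fin.ext h]
      simp
    · rw [show x = ⟨1, by omega⟩ from Fin.ext h]
      simp
  · have hlt : x.val - 2 < ((List.finRange n).drop 2).length := by simp; omega
    have hxe : ((List.finRange n).drop 2)[x.val - 2] = x := by
      ext; simp; omega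
    have hf := List.formPerm_apply_getElem _ hnd _ hlt
    rw [hxe] at hf
    have hv : (((List.finRange n).drop 2).formPerm x).val =
        if x.val = n - 1 then 2 else x.val + 1 := by
      rw [hf]
      simp only [List.getElem_drop, List.getElem_finRange, List.length_drop,
        List.length_finRange, Fin.val_cast]
      split_ifs with h
      · rw [h, show n - 1 - 2 + 1 = n - 2 by omega, Nat.mod_self]
      · rw [Nat.mod_eq_of_lt (by omega)]
        omega
    rw [Perm.mul_apply, swap_apply_of_ne_of_ne, hv]
    · grind
    · rw [Ne, Fin.ext_iff, hv]; grind
    · rw [Ne, Fin.ext_iff, hv]; grind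

theorem disjoint_swap_formPerm_drop_finRange {n : ℕ} (hn : 2 ≤ n) :
    Perm.Disjoint (swap (⟨0, by omega⟩ : Fin n) ⟨1, by omega⟩)
      ((List.finRange n).drop 2).formPerm := by
  intro x
  by_cases hx : x.val < 2
  · right
    exact List.formPerm_apply_of_notMem (notMem_drop_finRange hx)
  · left
    apply swap_apply_of_ne_of_ne <;> (rw [Ne, Fin.ext_iff]; simp; omega)

theorem isCycle_formPerm_drop_finRange {n : ℕ} (hn : 4 ≤ n) :
    ((List.finRange n).drop 2).formPerm.IsCycle :=
  List.isCycle_formPerm (List.nodup_finRange n).drop (by simp; omega)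

theorem card_support_formPerm_drop_finRange {n : ℕ} (hn : 4 ≤ n) :
    ((List.finRange n).drop 2).formPerm.support.card = n - 2 := by
  have hnd : ((List.finRange n).drop 2).Nodup := (List.nodup_finRange n).drop
  rw [List.support_formPerm_of_nodup _ hnd, List.toFinset_card_of_nodup hnd]
  · simp
  · intro x h
    have := congrArg List.length h
    simp at this
    omega

theorem orderOf_swap_mul_formPerm_drop_finRange {m : ℕ} (hm : 2 ≤ m) :
    orderOf (swap (⟨0, by omega⟩ : Fin (2 * m)) ⟨1, by omega⟩ *
      ((List.finRange (2 * m)).drop 2).formPerm) = 2 * m - 2 := by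
  rw [(disjoint_swap_formPerm_drop_finRange (by omega)).orderOf,
    (isCycle_formPerm_drop_finRange (by omega)).orderOf,
    card_support_formPerm_drop_finRange (by omega), (isCycle_swap (by simp)).orderOf,
    card_support_swap (by simp)]
  exact Nat.lcm_eq_right ⟨m - 1, by omega⟩

theorem sign_swap_mul_formPerm_drop_finRange {m : ℕ} (hm : 2 ≤ m) :
    sign (swap (⟨0, by omega⟩ : Fin (2 * m)) ⟨1, by omega⟩ *
      ((List.finRange (2 * m)).drop 2).formPerm) = 1 := by
  rw [Perm.sign_mul, sign_swap (by simp), (isCycle_formPerm_drop_finRange (by omega)).sign,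
    card_support_formPerm_drop_finRange (by omega),
    Even.neg_one_pow ⟨m - 1, by omega⟩]
  simp

/-- `a * b⁻¹` is the 5-cycle `(0 2 1 4 3)`. -/
theorem val_mul_inv_apply {n : ℕ} {a b : Perm (Fin n)} (hn : 8 ≤ n)
    (ha : ∀ x, (a x).val = if x.val = 0 then 1 else if x.val = 1 then 0 else
      if x.val = n - 1 then 2 else x.val + 1)
    (hb : ∀ x, (b x).val = if x.val = 0 then 2 else if x.val = 1 then 3 else
      if x.val = 2 then 4 else if x.val = 3 then 1 else if x.val = n - 1 then 0 else x.val + 1)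
    (x : Fin n) :
    ((a * b⁻¹) x).val = if x.val = 0 then 2 else if x.val = 1 then 4 else
      if x.val = 2 then 1 else if x.val = 3 then 0 else if x.val = 4 then 3 else x.val := by
  obtain ⟨y, rfl⟩ := b.surjective x
  rw [show (a * b⁻¹) (b y) = a y by simp]
  have h₁ := ha y
  have h₂ := hb y
  have := y.isLt
  clear ha hb
  split_ifs at h₁ <;> split_ifs at h₂ <;> split_ifs <;> omega

/-- The conjugate by `a` of the 5-cycle `(0 2 1 4 3)` is `(0 5 4 1 3)`. -/
theorem val_conj_five_cycle_apply {n : ℕ} {a : Perm (Fin n)} (hn : 8 ≤ n)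
    (ha : ∀ x, (a x).val = if x.val = 0 then 1 else if x.val = 1 then 0 else
      if x.val = n - 1 then 2 else x.val + 1)
    {c : Perm (Fin n)}
    (hc : ∀ x, (c x).val = if x.val = 0 then 2 else if x.val = 1 then 4 else
      if x.val = 2 then 1 else if x.val = 3 then 0 else if x.val = 4 then 3 else x.val)
    (x : Fin n) :
    ((a * c * a⁻¹) x).val = if x.val = 0 then 5 else if x.val = 1 then 3 else
      if x.val = 3 then 0 else if x.val = 4 then 1 else if x.val = 5 then 4 else x.val := by
  obtain ⟨y, rfl⟩ := a.surjective x
  rw [show (a * c * a⁻¹) (a y) = a (c y) by simp]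
  have h₁ := ha y
  have h₂ := hc y
  have h₃ := ha (c y)
  have := y.isLt
  clear ha hc
  split_ifs at h₂ <;> split_ifs at h₁ <;> try omega
  all_goals split_ifs at h₃ <;> try omega
  all_goals split_ifs <;> omega

/-- A 3-cycle as a word in two 5-cycles. -/
theorem swap_mul_swap_eq_of_five_cycles {n : ℕ} (hn : 6 ≤ n) {c d : Perm (Fin n)}
    (hc : ∀ x, (c x).val = if x.val = 0 then 2 else if x.val = 1 then 4 else
      if x.val = 2 then 1 else if x.val = 3 then 0 else if x.val = 4 then 3 else x.val)
    (hd : ∀ x, (d x).val = if x.val = 0 then 5 else if x.val = 1 then 3 else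
      if x.val = 3 then 0 else if x.val = 4 then 1 else if x.val = 5 then 4 else x.val) :
    swap (⟨0, by omega⟩ : Fin n) ⟨1, by omega⟩ * swap ⟨0, by omega⟩ ⟨2, by omega⟩ =
      d * d * c * d * c⁻¹ := by
  have ht (x : Fin n) : ((swap (⟨0, by omega⟩ : Fin n) ⟨1, by omega⟩ *
      swap (⟨0, by omega⟩ : Fin n) ⟨2, by omega⟩) x).val =
        if x.val = 0 then 2 else if x.val = 1 then 0 else if x.val = 2 then 1 else x.val := by
    simp only [Perm.mul_apply, swap_apply_def, Fin.ext_iff]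
    split_ifs <;> simp_all
  ext x
  obtain ⟨y, rfl⟩ := c.surjective x
  rw [show (d * d * c * d * c⁻¹) (c y) = d (d (c (d y))) by simp, ht]
  have h₁ := hc y
  have h₂ := hd y
  have h₃ := hc (d y)
  have h₄ := hd (c (d y))
  have h₅ := hd (d (c (d y)))
  clear hc hd ht
  split_ifs at h₁ <;> split_ifs at h₂ <;> try omega
  all_goals split_ifs at h₃ <;> try omega
  all_goals split_ifs at h₄ <;> try omega
  all_goals split_ifs at h₅ <;> try omega
  all_goals split_ifs <;> omega

/-- Conjugating by `a` shifts the third point of the 3-cycle `(0 2 1)`. -/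
theorem swap_mul_swap_mem_of_shift {n : ℕ} {a : Perm (Fin n)} (hn : 8 ≤ n)
    (ha : ∀ x, (a x).val = if x.val = 0 then 1 else if x.val = 1 then 0 else
      if x.val = n - 1 then 2 else x.val + 1)
    {H : Subgroup (Perm (Fin n))} (haH : a ∈ H)
    (h₂ : swap (⟨0, by omega⟩ : Fin n) ⟨1, by omega⟩ * swap ⟨0, by omega⟩ ⟨2, by omega⟩ ∈ H)
    {k : ℕ} (hk : 2 ≤ k) :
    ∀ hkn : k < n,
      swap (⟨0, by omega⟩ : Fin n) ⟨1, by omega⟩ * swap ⟨0, by omega⟩ ⟨k, hkn⟩ ∈ H := by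
  induction k, hk using Nat.le_induction with
  | base => exact fun _ ↦ h₂
  | succ k hk ih =>
    intro hkn
    have ha0 : a ⟨0, by omega⟩ = ⟨1, by omega⟩ := Fin.ext (by rw [ha]; simp)
    have ha1 : a ⟨1, by omega⟩ = ⟨0, by omega⟩ := Fin.ext (by rw [ha]; simp)
    have hak : a ⟨k, by omega⟩ = ⟨k + 1, hkn⟩ :=
      Fin.ext (by rw [ha]; dsimp only; split_ifs <;> omega)
    have h₀₁ := swap_apply_apply a ⟨0, by omega⟩ ⟨1, by omega⟩
    have h₀ₖ := swap_apply_apply a ⟨0, by omega⟩ ⟨k, by omega⟩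
    rw [ha0, ha1, swap_comm] at h₀₁
    rw [ha0, hak] at h₀ₖ
    have h := H.inv_mem (H.mul_mem (H.mul_mem haH (ih (by omega))) (H.inv_mem haH))
    convert h using 1
    rw [mul_swap_eq_swap_mul, swap_apply_left,
      swap_apply_of_ne_of_ne (by simp) (by simp; omega), h₀ₖ]
    nth_rw 1 [h₀₁]
    simp [mul_assoc]

theorem alternatingGroup_le_closure_pair {n : ℕ} {a b : Perm (Fin n)} (hn : 8 ≤ n)
    (ha : ∀ x, (a x).val = if x.val = 0 then 1 else if x.val = 1 then 0 else
      if x.val = n - 1 then 2 else x.val + 1)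
    (hb : ∀ x, (b x).val = if x.val = 0 then 2 else if x.val = 1 then 3 else
      if x.val = 2 then 4 else if x.val = 3 then 1 else if x.val = n - 1 then 0 else x.val + 1) :
    alternatingGroup (Fin n) ≤ Subgroup.closure {a, b} := by
  set H := Subgroup.closure {a, b}
  have haH : a ∈ H := Subgroup.subset_closure (by simp)
  have hbH : b ∈ H := Subgroup.subset_closure (by simp)
  have hcH : a * b⁻¹ ∈ H := H.mul_mem haH (H.inv_mem hbH)
  have hdH : a * (a * b⁻¹) * a⁻¹ ∈ H := H.mul_mem (H.mul_mem haH hcH) (H.inv_mem haH)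
  have hc := val_mul_inv_apply hn ha hb
  have h₂ := swap_mul_swap_eq_of_five_cycles (by omega) hc (val_conj_five_cycle_apply hn ha hc)
  refine alternatingGroup_le_of_swap_mul_swap_mem
    (p := ⟨0, by omega⟩) (q := ⟨1, by omega⟩) (by simp) fun k hk0 ↦ ?_
  obtain hk1 | hk2 : k.val = 1 ∨ 2 ≤ k.val := by
    have : k.val ≠ 0 := fun h ↦ hk0 (Fin.ext h)
    omega
  · rw [show k = ⟨1, by omega⟩ from Fin.ext hk1, swap_mul_self]
    exact H.one_mem
  · refine swap_mul_swap_mem_of_shift hn ha haH ?_ hk2 k.isLt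
    rw [h₂]
    exact H.mul_mem (H.mul_mem (H.mul_mem (H.mul_mem hdH hdH) hcH) hdH)
      (H.inv_mem hcH)

/-- `a * b` has the same cycle type as `a`: a transposition and a cycle on the remaining points. -/
theorem isConj_mul_of_val {n : ℕ} {a b : Perm (Fin n)} (hn : 8 ≤ n)
    (ha : ∀ x, (a x).val = if x.val = 0 then 1 else if x.val = 1 then 0 else
      if x.val = n - 1 then 2 else x.val + 1)
    (hb : ∀ x, (b x).val = if x.val = 0 then 2 else if x.val = 1 then 3 else
      if x.val = 2 then 4 else if x.val = 3 then 1 else if x.val = n - 1 then 0 else x.val + 1)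
    (hn2 : Even n) : IsConj a (a * b) := by
  obtain ⟨m, rfl⟩ := hn2
  have hlt (x : Fin (m + m)) : (if x.val = 0 then 0 else if x.val = 1 then 3 else
      if x.val = 2 then 1 else if x.val ≤ m then 2 * x.val - 2 else
      if x.val = m + 1 then 2 else 2 * x.val + 1 - 2 * m) < m + m := by grind
  obtain ⟨f, hfv⟩ : ∃ f : Fin (m + m) → Fin (m + m), ∀ x, (f x).val =
      if x.val = 0 then 0 else if x.val = 1 then 3 else if x.val = 2 then 1 else
      if x.val ≤ m then 2 * x.val - 2 else if x.val = m + 1 then 2 else 2 * x.val + 1 - 2 * m :=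
    ⟨fun x ↦ ⟨_, hlt x⟩, fun _ ↦ rfl⟩
  have hf : Function.Injective f := by
    intro x y h
    ext
    have h₁ := hfv x
    have h₂ := hfv y
    rw [h] at h₁
    split_ifs at h₁ <;> split_ifs at h₂ <;> omega
  let e := Equiv.ofBijective f (Finite.injective_iff_bijective.mp hf)
  rw [isConj_iff]
  refine ⟨e, ?_⟩
  rw [mul_inv_eq_iff_eq_mul]
  ext x
  simp only [Perm.mul_apply, e, Equiv.ofBijective_apply]
  have h₁ := ha x
  have h₂ := hfv x
  have h₃ := hb (f x)
  have h₄ := ha (b (f x))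
  have h₅ := hfv (a x)
  have := x.isLt
  clear ha hb hfv
  split_ifs at h₁ <;> split_ifs at h₂ <;> try omega
  all_goals split_ifs at h₃ <;> try omega
  all_goals split_ifs at h₄ <;> try omega
  all_goals split_ifs at h₅ <;> omega

theorem stmt_16 (m : ℕ) (hm : 4 ≤ m) :
    let a : Equiv.Perm (Fin (2 * m)) :=
      Equiv.swap ⟨0, by omega⟩ ⟨1, by omega⟩ * ((List.finRange (2 * m)).drop 2).formPerm
    let g : Equiv.Perm (Fin (2 * m)) :=
      [(⟨0, by omega⟩ : Fin (2 * m)), ⟨2, by omega⟩, ⟨3, by omega⟩].formPerm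
    let b : Equiv.Perm (Fin (2 * m)) := g⁻¹ * a * g
    Subgroup.closure {a, b} = alternatingGroup (Fin (2 * m)) ∧
      orderOf a = 2 * m - 2 ∧ orderOf b = 2 * m - 2 ∧ orderOf (a * b) = 2 * m - 2 := by
  intro a g b
  have ha (x : Fin (2 * m)) : (a x).val = if x.val = 0 then 1 else if x.val = 1 then 0 else
      if x.val = 2 * m - 1 then 2 else x.val + 1 :=
    val_swap_mul_formPerm_drop_finRange (by omega) x
  have hg (x : Fin (2 * m)) : (g x).val = if x.val = 0 then 2 else if x.val = 2 then 3 else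
      if x.val = 3 then 0 else x.val := by
    simp only [g, List.formPerm_cons_cons, List.formPerm_singleton, mul_one, Perm.mul_apply,
      swap_apply_def, Fin.ext_iff]
    split_ifs <;> simp_all
  have hgb (x : Fin (2 * m)) : g (b x) = a (g x) := by simp [b]
  have hb (x : Fin (2 * m)) : (b x).val = if x.val = 0 then 2 else if x.val = 1 then 3 else
      if x.val = 2 then 4 else if x.val = 3 then 1 else
      if x.val = 2 * m - 1 then 0 else x.val + 1 := by
    have h := congrArg Fin.val (hgb x)
    rw [hg, ha, hg] at h
    have := (b x).isLt
    grind
  have hord : orderOf a = 2 * m - 2 := orderOf_swap_mul_formPerm_drop_finRange (by omega)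
  have hsign : sign a = 1 := sign_swap_mul_formPerm_drop_finRange (by omega)
  refine ⟨le_antisymm ?_ ?_, hord, ?_, ?_⟩
  · rw [Subgroup.closure_le]
    rintro σ (rfl | rfl)
    · exact mem_alternatingGroup.mpr hsign
    · exact mem_alternatingGroup.mpr (by simp [b, hsign])
  · exact alternatingGroup_le_closure_pair (by omega) ha hb
  · rw [← hord]
    exact SemiconjBy.orderOf_eq g (by ext x; simp [b])
  · obtain ⟨e, he⟩ := isConj_mul_of_val (by omega) ha hb (even_two_mul m)
    rw [← hord, SemiconjBy.orderOf_eq (e : Perm (Fin (2 * m))) he]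
end

section
/- For every integer m ≥ 4, the permutations a = (1,2,...,2m-1) and b = a^g with g = (1,2m,3) generate the alternating group A_{2m}, and ord(a) = ord(b) = ord(ab) = 2m - 1. -/
open Equiv Equiv.Perm

/-- If all points other than the fixed point `p` lie in one cycle of `f`, then `f` is a cycle
with support the complement of `p`. -/
lemma isCycle_and_support_of_sameCycle {α : Type*} [Fintype α] [DecidableEq α] {f : Perm α}
    {x p : α} (hx : f x ≠ x) (hp : f p = p) (h : ∀ y, y ≠ p → f.SameCycle x y) :
    f.IsCycle ∧ f.support = {p}ᶜ := by
  refine ⟨⟨x, hx, fun y hy => h y ?_⟩, ?_⟩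
  · rintro rfl
    exact hy hp
  · ext y
    simp only [mem_support, Finset.mem_compl, Finset.mem_singleton]
    constructor
    · rintro hy rfl
      exact hy hp
    · intro hy hfy
      exact hx ((h y hy).apply_eq_self_iff.mpr hfy)

lemma viaEmbeddingHom_swap {α β : Type*} [DecidableEq α] [DecidableEq β] (ι : α ↪ β) (x y : α) :
    viaEmbeddingHom ι (swap x y) = swap (ι x) (ι y) := by
  ext z
  rw [viaEmbeddingHom_apply]
  by_cases hz : z ∈ Set.range ι
  · obtain ⟨w, rfl⟩ := hz
    rw [viaEmbedding_apply, ι.injective.map_swap]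
  · rw [viaEmbedding_apply_of_notMem _ _ _ hz, swap_apply_of_ne_of_ne]
    · rintro rfl
      exact hz ⟨x, rfl⟩
    · rintro rfl
      exact hz ⟨y, rfl⟩

/-- Two `5`-cycles sharing three points, arranged so that the square of their quotient is a
`3`-cycle. -/
lemma sq_five_cycle_mul_inv_five_cycle {α : Type*} [DecidableEq α] (ι : Fin 7 ↪ α) :
    (swap (ι 0) (ι 1) * swap (ι 1) (ι 3) * swap (ι 3) (ι 6) * swap (ι 6) (ι 2) *
      (swap (ι 2) (ι 3) * swap (ι 3) (ι 5) * swap (ι 5) (ι 6) * swap (ι 6) (ι 4))⁻¹) ^ 2 =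
      swap (ι 3) (ι 0) * swap (ι 3) (ι 1) := by
  simp only [← viaEmbeddingHom_swap, ← map_mul, ← map_inv, ← map_pow]
  refine congrArg _ (Equiv.ext ?_)
  rw [pow_two]
  decide

lemma formPerm_take_finRange_val {N k : ℕ} (hk : k ≤ N) (x : Fin N) :
    ((((List.finRange N).take k).formPerm x : Fin N) : ℕ) =
      if (x : ℕ) + 1 < k then (x : ℕ) + 1 else if (x : ℕ) + 1 = k then 0 else x := by
  set l := (List.finRange N).take k with hl
  have hlen : l.length = k := by simp [hl, hk]
  have hnd : l.Nodup := (List.nodup_finRange N).sublist (List.take_sublist _ _)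
  have hget : ∀ (i : ℕ) (hi : i < l.length), ((l[i] : Fin N) : ℕ) = i := by
    intro i hi
    simp [hl]
  by_cases hx : (x : ℕ) < k
  · have hx' : (x : ℕ) < l.length := by omega
    have hxl : l[(x : ℕ)] = x := Fin.ext (hget _ hx')
    have := List.formPerm_apply_getElem l hnd x hx'
    rw [hxl] at this
    rw [this, hget, hlen]
    split_ifs with h1 h2
    · exact Nat.mod_eq_of_lt h1
    · rw [h2, Nat.mod_self]
    · omega
  · have hxl : x ∉ l := by
      intro hmem
      obtain ⟨i, hi, h⟩ := List.mem_iff_getElem.mp hmem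
      have := hget i hi
      rw [h] at this
      omega
    rw [List.formPerm_apply_of_notMem hxl, if_neg (by omega), if_neg (by omega)]

/-- A permutation group which moves a point `p` and whose subgroup fixing `p` is transitive on
the other points is primitive. -/
lemma isPreprimitive_of_transitive_compl {α : Type*} {H : Subgroup (Perm α)} {p q r : α}
    (hr : ∃ c ∈ H, c r = p) (hrp : r ≠ p)
    (htrans : ∀ x, x ≠ p → ∃ h ∈ H, h p = p ∧ h q = x) :
    MulAction.IsPreprimitive H α := by
  have hback : ∀ x, x ≠ p → ∃ h ∈ H, h p = p ∧ h x = q := by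
    intro x hx
    obtain ⟨h, hH, h1, h2⟩ := htrans x hx
    exact ⟨h⁻¹, H.inv_mem hH, by rw [inv_eq_iff_eq, h1], by rw [inv_eq_iff_eq, h2]⟩
  have hto : ∀ x, ∃ h ∈ H, h x = p := by
    intro x
    by_cases hx : x = p
    · exact ⟨1, H.one_mem, by simp [hx]⟩
    · obtain ⟨h, hH, -, h2⟩ := hback x hx
      obtain ⟨k, kH, -, k2⟩ := htrans r hrp
      obtain ⟨c, cH, hc⟩ := hr
      exact ⟨c * k * h, H.mul_mem (H.mul_mem cH kH) hH, by simp [h2, k2, hc]⟩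
  have hpair : ∀ x y, x ≠ y → ∃ h ∈ H, h x = p ∧ h y = q := by
    intro x y hxy
    obtain ⟨h, hH, h1⟩ := hto x
    have hy : h y ≠ p := fun hy => hxy (h.injective (h1.trans hy.symm))
    obtain ⟨k, kH, k1, k2⟩ := hback _ hy
    exact ⟨k * h, H.mul_mem kH hH, by simp [h1, k1], by simp [k2]⟩
  apply MulAction.isPreprimitive_of_is_two_pretransitive
  rw [MulAction.is_two_pretransitive_iff]
  intro x y z w hxy hzw
  obtain ⟨h, hH, h1, h2⟩ := hpair x y hxy
  obtain ⟨k, kH, k1, k2⟩ := hpair z w hzw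
  refine ⟨⟨k⁻¹ * h, H.mul_mem (H.inv_mem kH) hH⟩, ?_, ?_⟩
  · change (k⁻¹ * h) x = z
    rw [mul_apply, h1, inv_eq_iff_eq, k1]
  · change (k⁻¹ * h) y = w
    rw [mul_apply, h2, inv_eq_iff_eq, k2]

lemma swap_val {N : ℕ} (x y z : Fin N) : ((swap x y z : Fin N) : ℕ) =
    if (z : ℕ) = x then (y : ℕ) else if (z : ℕ) = y then (x : ℕ) else z := by
  simp only [swap_apply_def, Fin.ext_iff]
  split_ifs <;> rfl

lemma conj_three_cycle_val {m : ℕ} (hm : 7 < 2 * m) {a : Perm (Fin (2 * m))}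
    (ha : ∀ x, ((a x : Fin (2 * m)) : ℕ) =
      if (x : ℕ) + 1 < 2 * m - 1 then (x : ℕ) + 1
      else if (x : ℕ) + 1 = 2 * m - 1 then 0 else x) (x : Fin (2 * m)) :
    ((((swap (⟨0, by omega⟩ : Fin (2 * m)) ⟨2 * m - 1, by omega⟩ *
      swap (⟨2 * m - 1, by omega⟩ : Fin (2 * m)) ⟨2, by omega⟩)⁻¹ * a *
      (swap (⟨0, by omega⟩ : Fin (2 * m)) ⟨2 * m - 1, by omega⟩ *
      swap (⟨2 * m - 1, by omega⟩ : Fin (2 * m)) ⟨2, by omega⟩)) x : Fin (2 * m)) : ℕ) =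
      if (x : ℕ) = 0 then 0 else if (x : ℕ) = 1 then 2 * m - 1
      else if (x : ℕ) = 2 then 1 else if (x : ℕ) = 2 * m - 1 then 3
      else if (x : ℕ) = 2 * m - 2 then 2 else x + 1 := by
  simp only [mul_inv_rev, swap_inv, mul_apply]
  have hx := x.isLt
  have h1 := swap_val (⟨2 * m - 1, by omega⟩ : Fin (2 * m)) ⟨2, by omega⟩ x
  generalize swap (⟨2 * m - 1, _⟩ : Fin (2 * m)) ⟨2, _⟩ x = x₁ at *
  have h2 := swap_val (⟨0, by omega⟩ : Fin (2 * m)) ⟨2 * m - 1, by omega⟩ x₁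
  generalize swap (⟨0, _⟩ : Fin (2 * m)) ⟨2 * m - 1, _⟩ x₁ = x₂ at *
  have h3 := ha x₂
  generalize a x₂ = x₃ at *
  have h4 := swap_val (⟨0, by omega⟩ : Fin (2 * m)) ⟨2 * m - 1, by omega⟩ x₃
  generalize swap (⟨0, _⟩ : Fin (2 * m)) ⟨2 * m - 1, _⟩ x₃ = x₄ at *
  rw [swap_val]
  clear ha
  dsimp only at *
  generalize (x : ℕ) = y at *
  generalize (x₁ : ℕ) = y₁ at *
  generalize (x₂ : ℕ) = y₂ at *
  generalize (x₃ : ℕ) = y₃ at *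
  generalize (x₄ : ℕ) = y₄ at *
  grind (splits := 20)

lemma isCycle_and_support_of_val {m : ℕ} (hm : 7 < 2 * m) {a : Perm (Fin (2 * m))}
    (ha : ∀ x, ((a x : Fin (2 * m)) : ℕ) =
      if (x : ℕ) + 1 < 2 * m - 1 then (x : ℕ) + 1
      else if (x : ℕ) + 1 = 2 * m - 1 then 0 else x) :
    (∀ y : Fin (2 * m), y ≠ ⟨2 * m - 1, by omega⟩ → a.SameCycle ⟨0, by omega⟩ y) ∧
      a.IsCycle ∧ a.support = {⟨2 * m - 1, by omega⟩}ᶜ := by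
  have hasame : ∀ k : ℕ, ∀ hk : k < 2 * m - 1,
      a.SameCycle ⟨0, by omega⟩ ⟨k, by omega⟩ := by
    intro k
    induction k with
    | zero => exact fun _ => SameCycle.refl _ _
    | succ k ih =>
      intro hk
      have h : a ⟨k, by omega⟩ = ⟨k + 1, by omega⟩ := Fin.ext (by rw [ha]; simp [hk])
      rw [← h, sameCycle_apply_right]
      exact ih (by omega)
  have halast : a ⟨2 * m - 1, by omega⟩ = ⟨2 * m - 1, by omega⟩ :=
    Fin.ext (by rw [ha]; dsimp only; split_ifs <;> omega)
  have ha' : ∀ y : Fin (2 * m), y ≠ ⟨2 * m - 1, by omega⟩ → a.SameCycle ⟨0, by omega⟩ y := by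
    intro y hy
    have hne : (y : ℕ) ≠ 2 * m - 1 := fun h => hy (Fin.ext h)
    exact hasame y (by omega)
  exact ⟨ha', isCycle_and_support_of_sameCycle
    (by rw [Ne, Fin.ext_iff, ha, if_pos (by dsimp only; omega)]; simp) halast ha'⟩

lemma isCycle_mul_and_support_of_val {m : ℕ} (hm : 7 < 2 * m) {a b : Perm (Fin (2 * m))}
    (ha : ∀ x, ((a x : Fin (2 * m)) : ℕ) =
      if (x : ℕ) + 1 < 2 * m - 1 then (x : ℕ) + 1
      else if (x : ℕ) + 1 = 2 * m - 1 then 0 else x)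
    (hb : ∀ x, ((b x : Fin (2 * m)) : ℕ) =
      if (x : ℕ) = 0 then 0 else if (x : ℕ) = 1 then 2 * m - 1
      else if (x : ℕ) = 2 then 1 else if (x : ℕ) = 2 * m - 1 then 3
      else if (x : ℕ) = 2 * m - 2 then 2 else x + 1) :
    (a * b).IsCycle ∧ (a * b).support = {⟨2, by omega⟩}ᶜ := by
  have hab : ∀ x : Fin (2 * m), (((a * b) x : Fin (2 * m)) : ℕ) =
      if (x : ℕ) = 0 then 1 else if (x : ℕ) = 1 then 2 * m - 1
      else if (x : ℕ) = 2 then 2 else if (x : ℕ) = 2 * m - 1 then 4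
      else if (x : ℕ) = 2 * m - 2 then 3 else if (x : ℕ) = 2 * m - 3 then 0 else x + 2 := by
    intro x
    have hx := x.isLt
    have h1 := hb x
    rw [mul_apply, ha]
    clear ha hb
    generalize (b x : ℕ) = z at *
    generalize (x : ℕ) = y at *
    grind (splits := 20)
  have hstep : ∀ (x y : ℕ) (hx : x < 2 * m) (hy : y < 2 * m),
      (if x = 0 then 1 else if x = 1 then 2 * m - 1 else if x = 2 then 2
        else if x = 2 * m - 1 then 4 else if x = 2 * m - 2 then 3
        else if x = 2 * m - 3 then 0 else x + 2) = y →
      (a * b).SameCycle ⟨0, by omega⟩ ⟨x, hx⟩ →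
      (a * b).SameCycle ⟨0, by omega⟩ ⟨y, hy⟩ := by
    intro x y hx hy h hs
    have h' : (a * b) ⟨x, hx⟩ = ⟨y, hy⟩ := Fin.ext ((hab _).trans h)
    rwa [← h', sameCycle_apply_right]
  have h1 : (a * b).SameCycle ⟨0, by omega⟩ ⟨1, by omega⟩ :=
    hstep 0 1 _ _ (by simp) (SameCycle.refl _ _)
  have hlast : (a * b).SameCycle ⟨0, by omega⟩ ⟨2 * m - 1, by omega⟩ :=
    hstep 1 (2 * m - 1) _ _ (by simp) h1
  have heven : ∀ k : ℕ, ∀ hk : 2 * k + 4 < 2 * m,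
      (a * b).SameCycle ⟨0, by omega⟩ ⟨2 * k + 4, hk⟩ := by
    intro k
    induction k with
    | zero =>
      exact fun hk => hstep (2 * m - 1) 4 (by omega) (by omega)
        (by split_ifs <;> omega) hlast
    | succ k ih =>
      exact fun hk => hstep (2 * k + 4) (2 * (k + 1) + 4) (by omega) (by omega)
        (by grind) (ih (by omega))
  have hodd : ∀ k : ℕ, ∀ hk : 2 * k + 3 < 2 * m - 1,
      (a * b).SameCycle ⟨0, by omega⟩ ⟨2 * k + 3, by omega⟩ := by
    intro k
    induction k with
    | zero =>
      exact fun hk => hstep (2 * (m - 3) + 4) 3 (by omega) (by omega)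
        (by grind) (heven _ (by omega))
    | succ k ih =>
      exact fun hk => hstep (2 * k + 3) (2 * (k + 1) + 3) (by omega) (by omega)
        (by grind) (ih (by omega))
  have hab' : ∀ y : Fin (2 * m), y ≠ ⟨2, by omega⟩ → (a * b).SameCycle ⟨0, by omega⟩ y := by
    rintro ⟨y, hy⟩ hne
    have hne' : y ≠ 2 := fun h => hne (Fin.ext h)
    by_cases hy0 : y = 0
    · subst hy0
      exact SameCycle.refl _ _
    by_cases hy1 : y = 1
    · subst hy1
      exact h1
    by_cases hyl : y = 2 * m - 1
    · subst hyl
      exact hlast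
    rcases Nat.even_or_odd' y with ⟨k, hk | hk⟩
    · obtain ⟨j, rfl⟩ : ∃ j, y = 2 * j + 4 := ⟨k - 2, by omega⟩
      exact heven j hy
    · obtain ⟨j, rfl⟩ : ∃ j, y = 2 * j + 3 := ⟨k - 1, by omega⟩
      exact hodd j (by omega)
  exact isCycle_and_support_of_sameCycle
    (by rw [Ne, Fin.ext_iff, hab]; simp) (Fin.ext (by rw [hab]; simp)) hab'

lemma alternatingGroup_le_closure_of_val {m : ℕ} (hm : 7 < 2 * m) {a b : Perm (Fin (2 * m))}
    (ha : ∀ x, ((a x : Fin (2 * m)) : ℕ) =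
      if (x : ℕ) + 1 < 2 * m - 1 then (x : ℕ) + 1
      else if (x : ℕ) + 1 = 2 * m - 1 then 0 else x)
    (hb : ∀ x, ((b x : Fin (2 * m)) : ℕ) =
      if (x : ℕ) = 0 then 0 else if (x : ℕ) = 1 then 2 * m - 1
      else if (x : ℕ) = 2 then 1 else if (x : ℕ) = 2 * m - 1 then 3
      else if (x : ℕ) = 2 * m - 2 then 2 else x + 1) :
    alternatingGroup (Fin (2 * m)) ≤ Subgroup.closure {a, b} := by
  obtain ⟨ha', hacyc, hasupp⟩ := isCycle_and_support_of_val hm ha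
  have halast : a ⟨2 * m - 1, by omega⟩ = ⟨2 * m - 1, by omega⟩ := by
    rw [← notMem_support, hasupp]
    simp
  set H := Subgroup.closure {a, b} with hH
  have haH : a ∈ H := Subgroup.subset_closure (by simp)
  have hbH : b ∈ H := Subgroup.subset_closure (by simp)
  let ι : Fin 7 ↪ Fin (2 * m) :=
    ⟨fun i => if h : i = 6 then ⟨2 * m - 1, by omega⟩ else ⟨i, by omega⟩, by
      intro i j hij
      dsimp only at hij
      split_ifs at hij <;> simp only [Fin.ext_iff] at * <;> omega⟩
  have hι : ∀ i, ((ι i : Fin (2 * m)) : ℕ) = if i = 6 then 2 * m - 1 else (i : ℕ) := by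
    intro i
    change ((if h : i = 6 then _ else _ : Fin (2 * m)) : ℕ) = _
    split_ifs <;> rfl
  clear_value ι
  have hι0 : ((ι 0 : Fin (2 * m)) : ℕ) = 0 := hι 0
  have hι1 : ((ι 1 : Fin (2 * m)) : ℕ) = 1 := hι 1
  have hι2 : ((ι 2 : Fin (2 * m)) : ℕ) = 2 := hι 2
  have hι3 : ((ι 3 : Fin (2 * m)) : ℕ) = 3 := hι 3
  have hι6 : ((ι 6 : Fin (2 * m)) : ℕ) = 2 * m - 1 := hι 6
  have hc : swap (ι 0) (ι 1) * swap (ι 1) (ι 3) * swap (ι 3) (ι 6) * swap (ι 6) (ι 2) =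
      a * b⁻¹ := by
    rw [eq_mul_inv_iff_mul_eq]
    ext x
    simp only [mul_apply]
    have hx := x.isLt
    have h1 := hb x
    have h2 := ha x
    generalize b x = x₁ at *
    generalize a x = x' at *
    have h3 := swap_val (ι 6) (ι 2) x₁
    generalize swap (ι 6) (ι 2) x₁ = x₂ at *
    have h4 := swap_val (ι 3) (ι 6) x₂
    generalize swap (ι 3) (ι 6) x₂ = x₃ at *
    have h5 := swap_val (ι 1) (ι 3) x₃
    generalize swap (ι 1) (ι 3) x₃ = x₄ at *
    rw [swap_val]
    simp only [hι0, hι1, hι2, hι3, hι6] at *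
    clear ha hb
    generalize (x : ℕ) = y at *
    generalize (x' : ℕ) = y' at *
    generalize (x₁ : ℕ) = y₁ at *
    generalize (x₂ : ℕ) = y₂ at *
    generalize (x₃ : ℕ) = y₃ at *
    generalize (x₄ : ℕ) = y₄ at *
    grind (splits := 20)
  have haι : ∀ i j : Fin 7, (i : ℕ) + 2 = j → j ≠ 6 → (a ^ 2) (ι i) = ι j := by
    intro i j hij hj
    ext
    simp only [pow_two, mul_apply, ha, hι]
    split_ifs <;> omega
  have haι6 : (a ^ 2) (ι 6) = ι 6 := by
    ext
    simp only [pow_two, mul_apply, ha, hι]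
    split_ifs <;> omega
  have hd : swap (ι 2) (ι 3) * swap (ι 3) (ι 5) * swap (ι 5) (ι 6) * swap (ι 6) (ι 4) =
      a ^ 2 * (a * b⁻¹) * (a ^ 2)⁻¹ := by
    rw [← hc, eq_mul_inv_iff_mul_eq]
    have e0 := haι 0 2 rfl (by decide)
    have e1 := haι 1 3 rfl (by decide)
    have e2 := haι 2 4 rfl (by decide)
    have e3 := haι 3 5 rfl (by decide)
    have e6 : ∀ x y, a ^ 2 * swap x y = swap ((a ^ 2) x) ((a ^ 2) y) * a ^ 2 :=
      fun x y => mul_swap_eq_swap_mul _ x y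
    generalize a ^ 2 = d at *
    rw [← mul_assoc, ← mul_assoc, ← mul_assoc, e6, mul_assoc _ d, e6, ← mul_assoc,
      mul_assoc _ d, e6, ← mul_assoc, mul_assoc _ d, e6, ← mul_assoc, e0, e1, e2, e3, haι6]
  have hcH : a * b⁻¹ ∈ H := H.mul_mem haH (H.inv_mem hbH)
  have hthree := sq_five_cycle_mul_inv_five_cycle ι
  rw [hc, hd] at hthree
  refine alternatingGroup_le_of_isPreprimitive_of_isThreeCycle_mem
    (isPreprimitive_of_transitive_compl (p := ⟨2 * m - 1, by omega⟩) (q := ⟨0, by omega⟩)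
      (r := ⟨1, by omega⟩) ⟨b, hbH, ?_⟩ ?_ ?_)
    (isThreeCycle_swap_mul_swap_same (a := ι 3) (b := ι 0) (c := ι 1) ?_ ?_ ?_) ?_
  · exact Fin.ext (by rw [hb]; simp)
  · simp only [Ne, Fin.ext_iff]
    omega
  · intro x hx
    obtain ⟨k, hk⟩ := ha' x hx
    exact ⟨a ^ k, H.zpow_mem haH k, zpow_apply_eq_self_of_apply_eq_self halast k, hk⟩
  · exact ι.injective.ne (by decide)
  · exact ι.injective.ne (by decide)
  · exact ι.injective.ne (by decide)
  · rw [← hthree]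
    exact H.pow_mem (H.mul_mem hcH (H.inv_mem
      (H.mul_mem (H.mul_mem (H.pow_mem haH 2) hcH) (H.inv_mem (H.pow_mem haH 2))))) 2

theorem stmt_17 (m : ℕ) (hm : 4 ≤ m) :
    let a : Equiv.Perm (Fin (2 * m)) := ((List.finRange (2 * m)).take (2 * m - 1)).formPerm
    let g : Equiv.Perm (Fin (2 * m)) :=
      [(⟨0, by omega⟩ : Fin (2 * m)), ⟨2 * m - 1, by omega⟩, ⟨2, by omega⟩].formPerm
    let b : Equiv.Perm (Fin (2 * m)) := g⁻¹ * a * g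
    Subgroup.closure {a, b} = alternatingGroup (Fin (2 * m)) ∧
      orderOf a = 2 * m - 1 ∧ orderOf b = 2 * m - 1 ∧ orderOf (a * b) = 2 * m - 1 := by
  intro a g b
  have ha : ∀ x : Fin (2 * m), ((a x : Fin (2 * m)) : ℕ) =
      if (x : ℕ) + 1 < 2 * m - 1 then (x : ℕ) + 1
      else if (x : ℕ) + 1 = 2 * m - 1 then 0 else x :=
    formPerm_take_finRange_val (by omega)
  have hg : g = swap ⟨0, by omega⟩ ⟨2 * m - 1, by omega⟩ *
      swap ⟨2 * m - 1, by omega⟩ ⟨2, by omega⟩ := by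
    simp only [g, List.formPerm_cons_cons, List.formPerm_singleton, mul_one]
  have hgb : b = g⁻¹ * a * g := rfl
  clear_value b g a
  have hb := conj_three_cycle_val (by omega) ha
  rw [← hg, ← hgb] at hb
  have hconj : SemiconjBy g b a := by
    rw [SemiconjBy, hgb]
    group
  obtain ⟨-, hacyc, hasupp⟩ := isCycle_and_support_of_val (by omega) ha
  obtain ⟨habcyc, habsupp⟩ := isCycle_mul_and_support_of_val (by omega) ha hb
  have hcard : a.support.card = 2 * m - 1 := by
    rw [hasupp, Finset.card_compl, Finset.card_singleton, Fintype.card_fin]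
  have horda : orderOf a = 2 * m - 1 := hacyc.orderOf.trans hcard
  refine ⟨le_antisymm ?_ (alternatingGroup_le_closure_of_val (by omega) ha hb), horda,
    (hconj.orderOf_eq g).trans horda, ?_⟩
  · have hsign : sign a = 1 := by
      rw [hacyc.sign, hcard, Odd.neg_one_pow ⟨m - 1, by omega⟩, neg_neg]
    rw [Subgroup.closure_le, Set.insert_subset_iff, Set.singleton_subset_iff]
    refine ⟨hsign, ?_⟩
    change sign b = 1
    simp [hgb, hsign]
  · rw [habcyc.orderOf, habsupp, Finset.card_compl, Finset.card_singleton, Fintype.card_fin]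
end
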